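/- arXiv:1712.09231 — 2 statements merged into one kernel-verified Lean document; each statement's English description precedes it below -/
import Mathlib

section
/- The genus-one coefficients of the cubic matrix model satisfy u_k^{(1)} = 0 for every k ≥ 0 (so the genus-one generating function u^{(1)} vanishes identically), and in ℤ⟦X⟧ the generating function V^{(1)} := Σ_{k≥0} v_k^{(1)} X^k satisfies (1 − 12X·U)·V^{(1)} = 1, where U is the spherical generating function; equivalently v^{(1)}(x) = 1/(1 − 12x·u^{(0)}(x)). -/
open PowerSeries Finset

theorem coeff_mk_mul_mk_eq_sum_range {R : Type*} [CommSemiring R] (f g : ℕ → R) (k : ℕ) :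
    coeff k (mk f * mk g) = ∑ p ∈ range (k + 1), f (k - p) * g p := by
  rw [mul_comm, coeff_mul, Nat.sum_antidiagonal_eq_sum_range_succ_mk]
  simp [mul_comm]

theorem coeff_mk_add_X_mul_derivative {R : Type*} [CommSemiring R] (f : ℕ → R) (k : ℕ) :
    coeff k (mk f + X * d⁄dX R (mk f)) = ((k : R) + 1) * f k := by
  cases k with
  | zero => simp
  | succ k =>
    rw [map_add, coeff_succ_X_mul, coeff_derivative, coeff_mk]
    push_cast
    ring

/-- The genus-one coefficients of the cubic matrix model: `u⁽¹⁾` vanishes identically,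
and `(1 - 12X·U)·V⁽¹⁾ = 1` in `ℤ⟦X⟧`. -/
theorem cubic_genus_one (u v u1 v1 : ℕ → ℤ)
    (hu0 : u 0 = 1)
    (hu : ∀ k : ℕ, u (k + 1) = 2 * ∑ p ∈ Finset.range (k + 1), u (k - p) * v p)
    (hv : ∀ k : ℕ, v k = 2 * u k + ∑ p ∈ Finset.range k, v (k - 1 - p) * v p)
    (hu10 : u1 0 = 0)
    (hu1 : ∀ k : ℕ, u1 (k + 1) =
        ∑ p ∈ Finset.range (k + 1),
          (-((p : ℤ) + 1) * u (k - p) * v p + 2 * u (k - p) * v1 p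
            + 2 * u1 (k - p) * v p))
    (hv1 : ∀ k : ℕ, v1 k = 2 * u1 k + ((k : ℤ) + 1) * u k
        + 2 * ∑ p ∈ Finset.range k, v (k - 1 - p) * v1 p) :
    (∀ k : ℕ, u1 k = 0) ∧
    (1 - 12 * PowerSeries.X * PowerSeries.mk u) * PowerSeries.mk v1 = 1 := by
  set U : ℤ⟦X⟧ := mk u with hU
  set V : ℤ⟦X⟧ := mk v with hV
  set U₁ : ℤ⟦X⟧ := mk u1 with hU₁
  set V₁ : ℤ⟦X⟧ := mk v1 with hV₁
  have eU : U = 1 + X * (2 * (U * V)) := by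
    ext k
    cases k with
    | zero => simp [hU, hu0]
    | succ k =>
      rw [map_add, coeff_succ_X_mul, two_mul, map_add, hU, hV, coeff_mk_mul_mk_eq_sum_range,
        coeff_mk, hu]
      simp [coeff_one, two_mul]
  have eV : V = 2 * U + X * (V * V) := by
    ext k
    cases k with
    | zero => simpa [hU, hV, two_mul] using hv 0
    | succ k =>
      rw [map_add, coeff_succ_X_mul, two_mul, map_add, hU, hV, coeff_mk_mul_mk_eq_sum_range,
        coeff_mk, coeff_mk, hv]
      simp [two_mul]
  have eU₁ : U₁ = X * (-(U * (V + X * d⁄dX ℤ V)) + 2 * (U * V₁) + 2 * (U₁ * V)) := by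
    have hD : V + X * d⁄dX ℤ V = mk fun k => ((k : ℤ) + 1) * v k := by
      ext k
      rw [hV, coeff_mk_add_X_mul_derivative, coeff_mk]
    rw [hD]
    ext k
    cases k with
    | zero => simp [hU₁, hu10]
    | succ k =>
      rw [coeff_succ_X_mul, two_mul, two_mul, hU, hV, hU₁, hV₁]
      simp only [map_add, map_neg, coeff_mk_mul_mk_eq_sum_range]
      rw [coeff_mk, hu1]
      simp only [← sum_add_distrib, ← sum_neg_distrib]
      exact sum_congr rfl fun p _ => by ring
  have eV₁ : V₁ = 2 * U₁ + (U + X * d⁄dX ℤ U) + X * (2 * (V * V₁)) := by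
    ext k
    rw [map_add, map_add, hU, coeff_mk_add_X_mul_derivative, two_mul, two_mul, hV₁, hU₁, hV]
    cases k with
    | zero => simp [hv1 0, two_mul]
    | succ k =>
      rw [coeff_succ_X_mul, coeff_mk, hv1]
      simp [coeff_mk_mul_mk_eq_sum_range, two_mul]
  have dU : d⁄dX ℤ U = 2 * (U * V) + X * (2 * (d⁄dX ℤ U * V + U * d⁄dX ℤ V)) := by
    have h := congrArg (d⁄dX ℤ) eU
    simp only [two_mul, map_add, Derivation.leibniz, smul_eq_mul, derivative_X,
      Derivation.map_one_eq_zero] at h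
    linear_combination h
  have dV : d⁄dX ℤ V = 2 * d⁄dX ℤ U + V * V + X * (2 * (V * d⁄dX ℤ V)) := by
    have h := congrArg (d⁄dX ℤ) eV
    simp only [two_mul, map_add, Derivation.leibniz, smul_eq_mul, derivative_X] at h
    linear_combination h
  generalize d⁄dX ℤ U = U' at *
  generalize d⁄dX ℤ V = V' at *
  obtain ⟨P, hP⟩ : ∃ P, P = 1 - 2 * X * V := ⟨_, rfl⟩
  have hUP : U * P = 1 := by rw [hP]; linear_combination eU
  have hWP : (2 * V₁ - (V + X * V')) * P = 4 * U₁ := by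
    rw [hP]; linear_combination 2 * eV₁ - eV - X * dV
  have hPU₁ : P * U₁ = X * U * (2 * V₁ - (V + X * V')) := by
    rw [hP]; linear_combination eU₁
  have hW : 2 * V₁ - (V + X * V') = 0 := by
    have h : (P ^ 2 - 4 * X * U) * (2 * V₁ - (V + X * V')) = 0 := by
      linear_combination P * hWP + 4 * hPU₁
    refine (mul_eq_zero.mp h).resolve_left fun h0 => ?_
    have := congrArg constantCoeff h0
    simp [hP] at this
  have hU₁0 : U₁ = 0 := by
    rw [hW, mul_zero] at hPU₁
    linear_combination U * hPU₁ - U₁ * hUP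
  refine ⟨fun k => by simpa [hU₁] using congrArg (coeff k) hU₁0, ?_⟩
  have hP2 : P ^ 2 = 1 - 8 * X * U := by
    rw [hP]; linear_combination -4 * X * eV
  have hU' : U' * (1 - 12 * X * U) = 4 * U ^ 2 := by
    have h1 : U' * P = 2 * U * V + 2 * X * U * V' := by rw [hP]; linear_combination dU
    have h2 : V' * P = 2 * U' + V * V := by rw [hP]; linear_combination dV
    linear_combination P * h1 + 2 * X * U * h2 - U' * hP2 + 2 * U * V * hP + 2 * U * eV
  have hV₁U : V₁ = U * (U + X * U') := by
    have h : V₁ * P = U + X * U' := by rw [hP]; linear_combination eV₁ + 2 * hU₁0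
    linear_combination U * h - V₁ * hUP
  rw [hV₁U]
  linear_combination X * U * hU' - U ^ 2 * hP2 + (U * P + 1) * hUP
end

section
/- In ℤ⟦X⟧, the genus-two generating functions U^{(2)} := Σ_{k≥0} u_k^{(2)} X^k and V^{(2)} := Σ_{k≥0} v_k^{(2)} X^k of the cubic matrix model satisfy 4·(3 − U^2)·(1 − 12X·U)^3·U^{(2)} = X·U^2 + 72X^2·U − X and 2X·U^2·V^{(2)} = U^{(2)}, where U is the spherical generating function; equivalently u^{(2)}(x) = (x·[u^{(0)}]^2 + 72x^2·u^{(0)} − x)/(4(3 − [u^{(0)}]^2)(1 − 12x·u^{(0)})^3) and v^{(2)}(x) = u^{(2)}(x)/(2x·[u^{(0)}(x)]^2). -/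
open PowerSeries Finset

/-- The formal derivative of `X * PowerSeries.mk a` has coefficients `(k + 1) * a k`. -/
theorem mk_add_one_mul (a : ℕ → ℤ) :
    (PowerSeries.mk fun k => ((k : ℤ) + 1) * a k) =
      PowerSeries.mk a + X * derivative ℤ (PowerSeries.mk a) := by
  ext k
  cases k with
  | zero => simp
  | succ k =>
    simp only [coeff_mk, map_add, coeff_succ_X_mul, coeff_derivative]
    push_cast
    ring

theorem mk_natCast_mul (a : ℕ → ℤ) :
    (PowerSeries.mk fun k => (k : ℤ) * a k) = X * derivative ℤ (PowerSeries.mk a) := by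
  ext k
  cases k with
  | zero => simp
  | succ k =>
    simp only [coeff_mk, coeff_succ_X_mul, coeff_derivative]
    push_cast
    ring

theorem coeff_two_mul (f : ℤ⟦X⟧) (k : ℕ) : coeff k (2 * f) = 2 * coeff k f := by
  rw [two_mul, map_add, two_mul]

theorem two_mul_mk_choose_two_mul (a : ℕ → ℤ) :
    2 * (PowerSeries.mk fun k => ((k + 1).choose 2 : ℤ) * a k) =
      2 * X * derivative ℤ (PowerSeries.mk a)
        + X ^ 2 * derivative ℤ (derivative ℤ (PowerSeries.mk a)) := by
  have hchoose (k : ℕ) : 2 * ((k + 1).choose 2 : ℤ) = (k + 1) * k := by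
    have h := Nat.add_one_mul_choose_eq k 1
    rw [Nat.choose_one_right] at h
    rw [mul_comm]
    exact_mod_cast h.symm
  rw [mul_assoc]
  ext k
  rcases k with _ | _ | k
  · simp [coeff_two_mul]
  · simp [pow_two, mul_assoc, coeff_two_mul, coeff_succ_X_mul, coeff_derivative]
  · simp only [pow_two, mul_assoc, map_add, coeff_two_mul, coeff_mk, coeff_succ_X_mul,
      coeff_derivative]
    have := hchoose (k + 1 + 1)
    push_cast at this ⊢
    linear_combination a (k + 1 + 1) * this

theorem coeff_mk_mul_mk (a b : ℕ → ℤ) (k : ℕ) :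
    coeff k (PowerSeries.mk a * PowerSeries.mk b) = ∑ p ∈ range (k + 1), a (k - p) * b p := by
  rw [mul_comm, coeff_mul, Nat.sum_antidiagonal_eq_sum_range_succ_mk]
  simp [mul_comm]

theorem coeff_X_mul_mk_mul_mk (a b : ℕ → ℤ) (k : ℕ) :
    coeff k (X * (PowerSeries.mk a * PowerSeries.mk b)) = ∑ p ∈ range k, a (k - 1 - p) * b p := by
  cases k with
  | zero => simp
  | succ k => rw [coeff_succ_X_mul, coeff_mk_mul_mk, Nat.add_sub_cancel]

theorem derivation_ofNat {R A : Type*} [CommRing R] [CommRing A] [Algebra R A]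
    (D : Derivation R A A) (n : ℕ) [n.AtLeastTwo] : D ofNat(n) = 0 :=
  D.map_natCast n

/-- The algebraic equation for the spherical generating function. -/
theorem spherical_cubic {A : Type*} [CommRing A] {x U V : A}
    (hU : U = 1 + 2 * x * (U * V)) (hV : V = 2 * U + x * (V * V)) :
    8 * x * U ^ 3 = U ^ 2 - 1 := by
  linear_combination -(1 + U - 2 * x * U * V) * hU - 4 * x * U ^ 2 * hV

section Derivation

variable {R A : Type*} [CommRing R] [CommRing A] [IsDomain A] [Algebra R A]
  {D : Derivation R A A} {x U V U₁ V₁ : A}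

/-- The differential equation for the spherical generating function. -/
theorem spherical_derivation (hx : D x = 1) (h2 : (2 : A) ≠ 0)
    (hU : U = 1 + 2 * x * (U * V)) (hV : V = 2 * U + x * (V * V)) :
    (1 - 12 * x * U) * D U = 4 * U ^ 2 := by
  have h := congrArg D (spherical_cubic hU hV)
  simp only [map_sub, Derivation.leibniz, Derivation.leibniz_pow,
    Derivation.map_one_eq_zero, derivation_ofNat, hx, smul_eq_mul, nsmul_eq_mul] at h
  push_cast at h
  apply mul_left_cancel₀ h2
  linear_combination -(2 * (1 - 12 * x * U) * D U - 8 * U ^ 2) * hU - (1 - 2 * x * V) * h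

/-- The function `U⁽¹⁾` vanishes, `(1 - 12xU) V⁽¹⁾ = 1` and `2V⁽¹⁾ = D(xV)`. -/
theorem genus_one (hx : D x = 1) (h2 : (2 : A) ≠ 0) (hw : 1 - 12 * x * U ≠ 0)
    (hU : U = 1 + 2 * x * (U * V)) (hV : V = 2 * U + x * (V * V))
    (hU₁ : U₁ = x * (-(U * (V + x * D V)) + 2 * (U * V₁) + 2 * (U₁ * V)))
    (hV₁ : V₁ = 2 * U₁ + (U + x * D U) + 2 * (x * (V * V₁))) :
    (1 - 12 * x * U) * V₁ = 1 ∧ 2 * V₁ = V + x * D V := by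
  have hcub := spherical_cubic hU hV
  have hDU := spherical_derivation hx h2 hU hV
  have hU0 : U ≠ 0 := by rintro rfl; simp at hU
  have hT : 2 * U ^ 2 * (V + x * D V) = D U := by
    have h := congrArg D hU
    simp only [map_add, Derivation.leibniz, Derivation.map_one_eq_zero, derivation_ofNat,
      hx, smul_eq_mul] at h
    linear_combination -U * h + D U * hU
  have hU₁' : U₁ = x * U ^ 2 * (2 * V₁ - (V + x * D V)) := by
    linear_combination U * hU₁ - U₁ * hU
  have hV₁' : V₁ = U * (2 * U₁ + (U + x * D U)) := by
    linear_combination U * hV₁ - V₁ * hU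
  have hzero : U₁ = 0 := by
    apply mul_left_cancel₀ (mul_ne_zero (mul_ne_zero h2 (pow_ne_zero 2 hU0)) hw)
    linear_combination -2 * U₁ * hcub + 2 * hU₁' + 4 * x * U ^ 2 * hV₁' - x * hT
      - x * U ^ 2 * hDU - x * D U * hcub
  subst hzero
  have hV₁w : (1 - 12 * x * U) * V₁ = 1 := by
    apply mul_left_cancel₀ (mul_ne_zero h2 (pow_ne_zero 2 hU0))
    linear_combination 2 * U ^ 2 * (1 - 12 * x * U) * hV₁' + 2 * U ^ 3 * x * hDU
      - 2 * U ^ 2 * hcub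
  refine ⟨hV₁w, ?_⟩
  apply mul_left_cancel₀ (mul_ne_zero (mul_ne_zero h2 (pow_ne_zero 2 hU0)) hw)
  linear_combination 4 * U ^ 2 * hV₁w - (1 - 12 * x * U) * hT - hDU

/-- The genus-two formulas for any derivation `D` with `D x = 1`. -/
theorem genus_two {U₂ V₂ Y Z : A} (hx : D x = 1) (h2 : (2 : A) ≠ 0) (hw : 1 - 12 * x * U ≠ 0)
    (hU : U = 1 + 2 * x * (U * V)) (hV : V = 2 * U + x * (V * V))
    (hU₁ : U₁ = x * (-(U * (V + x * D V)) + 2 * (U * V₁) + 2 * (U₁ * V)))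
    (hV₁ : V₁ = 2 * U₁ + (U + x * D U) + 2 * (x * (V * V₁)))
    (hY : 2 * Y = 2 * x * D V + x ^ 2 * D (D V))
    (hZ : 2 * Z = 2 * x * D U + x ^ 2 * D (D U))
    (hU₂ : U₂ = x * (2 * (U * V₂) - U * (x * D V₁) + U * Y + 2 * (U₂ * V)))
    (hV₂ : V₂ = 2 * U₂ + Z + (2 * (x * (V * V₂)) + x * (V₁ * V₁))) :
    4 * (3 - U ^ 2) * (1 - 12 * x * U) ^ 3 * U₂ = x * U ^ 2 + 72 * x ^ 2 * U - x ∧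
      2 * x * U ^ 2 * V₂ = U₂ := by
  have hcub := spherical_cubic hU hV
  have hDU := spherical_derivation hx h2 hU hV
  obtain ⟨hV₁w, hV₁V⟩ := genus_one hx h2 hw hU hV hU₁ hV₁
  have hDV₁ : x * D V₁ = Y := by
    have h := congrArg D hV₁V
    simp only [map_add, Derivation.leibniz, derivation_ofNat, hx, smul_eq_mul] at h
    apply mul_left_cancel₀ h2
    linear_combination x * h - hY
  have hDDU : (1 - 12 * x * U) * D (D U) = 8 * U * D U + 12 * (U + x * D U) * D U := by
    have h := congrArg D hDU
    simp only [map_sub, Derivation.leibniz, Derivation.leibniz_pow,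
      Derivation.map_one_eq_zero, derivation_ofNat, hx, smul_eq_mul, nsmul_eq_mul] at h
    push_cast at h
    linear_combination h
  have hUV₂ : 2 * x * U ^ 2 * V₂ = U₂ := by
    linear_combination U₂ * hU - U * hU₂ + x * U ^ 2 * hDV₁
  refine ⟨?_, hUV₂⟩
  have hV₂' : V₂ = U * (2 * U₂ + Z + x * (V₁ * V₁)) := by
    linear_combination U * hV₂ - V₂ * hU
  have hU₂' : (3 - U ^ 2) * U₂ = 4 * x * U ^ 3 * (Z + x * V₁ ^ 2) := by
    linear_combination U₂ * hcub - 2 * hUV₂ + 4 * x * U ^ 2 * hV₂'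
  linear_combination 4 * (1 - 12 * x * U) ^ 3 * hU₂'
    + 8 * x * U ^ 3 * (1 - 12 * x * U) ^ 3 * hZ
    + 8 * x ^ 3 * U ^ 3 * (1 - 12 * x * U) ^ 2 * hDDU
    + (8 * x ^ 3 * U ^ 3 * (20 * U * (1 - 12 * x * U)
          + 12 * x * ((1 - 12 * x * U) * D U + 4 * U ^ 2))
      + 16 * x ^ 2 * U ^ 3 * (1 - 12 * x * U) ^ 2) * hDU
    + 16 * x ^ 2 * U ^ 3 * (1 - 12 * x * U) * ((1 - 12 * x * U) * V₁ + 1) * hV₁w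
    + (x - 8 * x ^ 2 * U * (9 + 8 * U ^ 2 * (1 - 6 * x * U))) * hcub

end Derivation

/-- The genus-two generating functions of the cubic matrix model satisfy
`4·(3 - U²)·(1 - 12X·U)³·U⁽²⁾ = X·U² + 72X²·U - X` and `2X·U²·V⁽²⁾ = U⁽²⁾`
in `ℤ⟦X⟧`. -/
theorem cubic_genus_two (u v u1 v1 u2 v2 : ℕ → ℤ)
    (hu0 : u 0 = 1)
    (hu : ∀ k : ℕ, u (k + 1) = 2 * ∑ p ∈ Finset.range (k + 1), u (k - p) * v p)
    (hv : ∀ k : ℕ, v k = 2 * u k + ∑ p ∈ Finset.range k, v (k - 1 - p) * v p)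
    (hu10 : u1 0 = 0)
    (hu1 : ∀ k : ℕ, u1 (k + 1) =
        ∑ p ∈ Finset.range (k + 1),
          (-((p : ℤ) + 1) * u (k - p) * v p + 2 * u (k - p) * v1 p
            + 2 * u1 (k - p) * v p))
    (hv1 : ∀ k : ℕ, v1 k = 2 * u1 k + ((k : ℤ) + 1) * u k
        + 2 * ∑ p ∈ Finset.range k, v (k - 1 - p) * v1 p)
    (hu20 : u2 0 = 0)
    (hu2 : ∀ k : ℕ, u2 (k + 1) =
        ∑ p ∈ Finset.range (k + 1),
          (2 * u (k - p) * v2 p - (p : ℤ) * u (k - p) * v1 p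
            + (Nat.choose (p + 1) 2 : ℤ) * u (k - p) * v p
            + 2 * u2 (k - p) * v p))
    (hv2 : ∀ k : ℕ, v2 k = 2 * u2 k + (Nat.choose (k + 1) 2 : ℤ) * u k
        + ∑ p ∈ Finset.range k, (2 * v (k - 1 - p) * v2 p + v1 (k - 1 - p) * v1 p)) :
    4 * (3 - (PowerSeries.mk u) ^ 2) *
        (1 - 12 * PowerSeries.X * PowerSeries.mk u) ^ 3 * PowerSeries.mk u2 =
      PowerSeries.X * (PowerSeries.mk u) ^ 2
        + 72 * PowerSeries.X ^ 2 * PowerSeries.mk u - PowerSeries.X ∧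
    2 * PowerSeries.X * (PowerSeries.mk u) ^ 2 * PowerSeries.mk v2 =
      PowerSeries.mk u2 := by
  have hU : PowerSeries.mk u = 1 + 2 * X * (PowerSeries.mk u * PowerSeries.mk v) := by
    rw [mul_assoc]
    ext k
    cases k with
    | zero => simp [hu0]
    | succ k =>
      simp [coeff_one, coeff_two_mul, coeff_succ_X_mul, coeff_mk_mul_mk, hu]
  have hV : PowerSeries.mk v = 2 * PowerSeries.mk u + X * (PowerSeries.mk v * PowerSeries.mk v) := by
    ext k
    rw [map_add, coeff_X_mul_mk_mul_mk, coeff_two_mul, coeff_mk, coeff_mk, hv]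
  have hU1 : PowerSeries.mk u1 =
      X * (-(PowerSeries.mk u * (PowerSeries.mk v + X * derivative ℤ (PowerSeries.mk v)))
        + 2 * (PowerSeries.mk u * PowerSeries.mk v1) + 2 * (PowerSeries.mk u1 * PowerSeries.mk v)) := by
    rw [← mk_add_one_mul]
    ext k
    cases k with
    | zero => simp [hu10]
    | succ k =>
      simp only [coeff_succ_X_mul, map_add, map_neg, coeff_two_mul, coeff_mk_mul_mk, coeff_mk, hu1,
        mul_sum, ← sum_neg_distrib, ← sum_add_distrib]
      exact sum_congr rfl fun p _ => by ring
  have hV1 : PowerSeries.mk v1 = 2 * PowerSeries.mk u1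
      + (PowerSeries.mk u + X * derivative ℤ (PowerSeries.mk u))
      + 2 * (X * (PowerSeries.mk v * PowerSeries.mk v1)) := by
    rw [← mk_add_one_mul]
    ext k
    simp only [map_add, coeff_X_mul_mk_mul_mk, coeff_two_mul, coeff_mk]
    exact hv1 k
  set Y : ℤ⟦X⟧ := PowerSeries.mk fun k => ((k + 1).choose 2 : ℤ) * v k with hYdef
  set Z : ℤ⟦X⟧ := PowerSeries.mk fun k => ((k + 1).choose 2 : ℤ) * u k with hZdef
  have hU2 : PowerSeries.mk u2 = X * (2 * (PowerSeries.mk u * PowerSeries.mk v2)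
      - PowerSeries.mk u * (X * derivative ℤ (PowerSeries.mk v1))
      + PowerSeries.mk u * Y + 2 * (PowerSeries.mk u2 * PowerSeries.mk v)) := by
    rw [← mk_natCast_mul]
    ext k
    cases k with
    | zero => simp [hu20]
    | succ k =>
      simp only [hYdef, coeff_succ_X_mul, map_add, map_sub, coeff_two_mul, coeff_mk_mul_mk,
        coeff_mk, hu2, mul_sum, ← sum_sub_distrib, ← sum_add_distrib]
      exact sum_congr rfl fun p _ => by ring
  have hV2 : PowerSeries.mk v2 = 2 * PowerSeries.mk u2 + Z
      + (2 * (X * (PowerSeries.mk v * PowerSeries.mk v2))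
        + X * (PowerSeries.mk v1 * PowerSeries.mk v1)) := by
    ext k
    simp only [hZdef, map_add, coeff_X_mul_mk_mul_mk, coeff_two_mul, coeff_mk]
    rw [hv2, sum_add_distrib, mul_sum]
    simp only [mul_assoc]
  have hY : 2 * Y = _ := two_mul_mk_choose_two_mul v
  have hZ : 2 * Z = _ := two_mul_mk_choose_two_mul u
  clear_value Y Z
  have hw : (1 - 12 * X * PowerSeries.mk u : ℤ⟦X⟧) ≠ 0 := fun h => by
    simpa using congrArg constantCoeff h
  have h2 : (2 : ℤ⟦X⟧) ≠ 0 := fun h => by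
    have := congrArg constantCoeff h
    rw [map_ofNat, map_zero] at this
    exact two_ne_zero this
  exact genus_two (D := derivative ℤ) derivative_X h2 hw hU hV hU1 hV1 hY hZ hU2 hV2
end
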